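/- arXiv:2602.19870 — 3 statements merged into one kernel-verified Lean document; each statement's English description precedes it below -/
import Mathlib

section
/- Let d be a positive integer and f : ℝ^d → ℝ a nonnegative measurable probability density with respect to Lebesgue measure (∫ f = 1), with finite mean vector μ = ∫ x f(x) dx and finite second moment, and suppose f log f is Lebesgue integrable. Define the differential entropy h(f) = -∫ f(x) log f(x) dx and the per-dimension mean-square deviation ξ = (1/d) ∫ ‖x − μ‖² f(x) dx. Then ξ ≥ (1/(2πe)) · exp( 2 h(f) / d ). -/
open MeasureTheory Real

section GaussianComparison

variable {V : Type*} [NormedAddCommGroup V] [InnerProductSpace ℝ V] [FiniteDimensional ℝ V]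
  [MeasurableSpace V] [BorelSpace V]

/-- Finiteness of the second moment about the origin implies finiteness about any point. -/
theorem integrable_norm_sub_sq_mul {f : V → ℝ} (hf : Integrable f)
    (hf0 : ∀ x, 0 ≤ f x) (hsec : Integrable (fun x => ‖x‖ ^ 2 * f x)) (m : V) :
    Integrable (fun x => ‖x - m‖ ^ 2 * f x) := by
  refine ((hsec.const_mul 2).add (hf.const_mul (2 * ‖m‖ ^ 2))).mono'
    ((by fun_prop : Continuous fun x : V => ‖x - m‖ ^ 2).aestronglyMeasurable.mul
      hf.aestronglyMeasurable) (.of_forall fun x => ?_)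
  have hx := hf0 x
  have hsq : ‖x - m‖ ^ 2 ≤ 2 * ‖x‖ ^ 2 + 2 * ‖m‖ ^ 2 := by
    nlinarith [norm_sub_le x m, norm_nonneg (x - m), sq_nonneg (‖x‖ - ‖m‖)]
  rw [Real.norm_of_nonneg (by positivity)]
  simpa only [Pi.add_apply, add_mul, mul_assoc] using mul_le_mul_of_nonneg_right hsq hx

/-- A probability density with respect to Lebesgue measure has positive second moment
about every point. -/
theorem integral_norm_sub_sq_mul_pos [Nontrivial V] {f : V → ℝ} (hf0 : ∀ x, 0 ≤ f x)
    (hf1 : ∫ x, f x = 1) (m : V) (hint : Integrable (fun x => ‖x - m‖ ^ 2 * f x)) :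
    0 < ∫ x, ‖x - m‖ ^ 2 * f x := by
  have hnonneg : ∀ x, 0 ≤ ‖x - m‖ ^ 2 * f x := fun x => mul_nonneg (by positivity) (hf0 x)
  refine (integral_nonneg hnonneg).lt_of_ne' fun hzero => ?_
  have hae := (integral_eq_zero_iff_of_nonneg hnonneg hint).1 hzero
  have hne : ∀ᵐ x : V, x ≠ m := by simp [ae_iff]
  have hf : f =ᵐ[volume] 0 := by
    filter_upwards [hae, hne] with x hx hxm
    simpa [sub_eq_zero, hxm] using hx
  simp [integral_congr_ae hf] at hf1

theorem mul_log_sub_mul_log_le {a b : ℝ} (ha : 0 ≤ a) (hb : 0 < b) :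
    a * log b - a * log a ≤ b - a := by
  rcases ha.eq_or_lt with rfl | ha
  · simpa using hb.le
  · have hlog := log_le_sub_one_of_pos (div_pos hb ha)
    rw [log_div hb.ne' ha.ne'] at hlog
    calc a * log b - a * log a = a * (log b - log a) := by ring
      _ ≤ a * (b / a - 1) := by gcongr
      _ = b - a := by field_simp

/-- Gibbs' inequality against the Gaussian density proportional to `exp (-b * ‖x - m‖ ^ 2)`. -/
theorem entropy_le_gaussian_cross_entropy {f : V → ℝ} (hf0 : ∀ x, 0 ≤ f x)
    (hf1 : ∫ x, f x = 1) (m : V) (hint : Integrable (fun x => ‖x - m‖ ^ 2 * f x))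
    (hlog : Integrable (fun x => f x * log (f x))) {b : ℝ} (hb : 0 < b) :
    -∫ x, f x * log (f x) ≤
      b * (∫ x, ‖x - m‖ ^ 2 * f x) + (Module.finrank ℝ V / 2 : ℝ) * log (π / b) := by
  have hf : Integrable f := .of_integral_ne_zero (by simp [hf1])
  set Z : ℝ := (π / b) ^ (Module.finrank ℝ V / 2 : ℝ) with hZ
  have hZpos : 0 < Z := by positivity
  have hG : ∫ x, exp (-b * ‖x - m‖ ^ 2) = Z := by
    rw [integral_sub_right_eq_self (fun x : V => exp (-b * ‖x‖ ^ 2)) m,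
      GaussianFourier.integral_rexp_neg_mul_sq_norm hb]
  have hGint : Integrable (fun x => exp (-b * ‖x - m‖ ^ 2)) :=
    .of_integral_ne_zero (by rw [hG]; exact hZpos.ne')
  have hle : ∀ x, -log Z * f x - b * (‖x - m‖ ^ 2 * f x) - f x * log (f x) ≤
      Z⁻¹ * exp (-b * ‖x - m‖ ^ 2) - f x := fun x => by
    have hx := mul_log_sub_mul_log_le (hf0 x)
      (by positivity : 0 < Z⁻¹ * exp (-b * ‖x - m‖ ^ 2))
    rw [log_mul (by positivity) (by positivity), log_inv, log_exp] at hx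
    linarith
  have hdiff : Integrable (fun x => -log Z * f x - b * (‖x - m‖ ^ 2 * f x)) :=
    (hf.const_mul _).sub (hint.const_mul b)
  have hmono := integral_mono (hdiff.sub hlog) ((hGint.const_mul Z⁻¹).sub hf) hle
  simp only [Pi.sub_apply] at hmono
  rw [integral_sub hdiff hlog,
    integral_sub (hf.const_mul _) (hint.const_mul b), integral_sub (hGint.const_mul _) hf,
    integral_const_mul, integral_const_mul, integral_const_mul, hG, hf1,
    inv_mul_cancel₀ hZpos.ne', hZ, log_rpow (by positivity)] at hmono
  linarith

end GaussianComparison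

/-- For a density on `ℝ^d` with mean `μ`, the per-dimension mean-square deviation is at least
`(1/(2πe)) · exp(2 h(f)/d)` where `h(f)` is the differential entropy. -/
theorem per_dimension_mse_entropy_lower_bound
    (d : ℕ) (hd : 0 < d)
    (f : EuclideanSpace ℝ (Fin d) → ℝ)
    (hfmeas : Measurable f) (hf0 : ∀ x, 0 ≤ f x)
    (hf1 : ∫ x, f x = 1)
    (μ : EuclideanSpace ℝ (Fin d))
    (hμint : Integrable (fun x => f x • x))
    (hμ : μ = ∫ x, f x • x)
    (hsec : Integrable (fun x => ‖x‖ ^ 2 * f x))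
    (hlog : Integrable (fun x => f x * Real.log (f x)))
    (h ξ : ℝ)
    (hh : h = -∫ x, f x * Real.log (f x))
    (hξ : ξ = (1 / (d : ℝ)) * ∫ x, ‖x - μ‖ ^ 2 * f x) :
    (1 / (2 * Real.pi * Real.exp 1)) * Real.exp (2 * h / d) ≤ ξ := by
  have : Nonempty (Fin d) := ⟨⟨0, hd⟩⟩
  have hd' : (0 : ℝ) < d := by exact_mod_cast hd
  have hint := integrable_norm_sub_sq_mul (.of_integral_ne_zero (by simp [hf1])) hf0 hsec μ
  have hpos := integral_norm_sub_sq_mul_pos hf0 hf1 μ hint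
  have hξpos : 0 < ξ := by rw [hξ]; positivity
  have hS : ∫ x, ‖x - μ‖ ^ 2 * f x = d * ξ := by rw [hξ]; field_simp
  have hent := entropy_le_gaussian_cross_entropy hf0 hf1 μ hint hlog
    (by positivity : 0 < 1 / (2 * ξ))
  rw [← hh, hS, finrank_euclideanSpace_fin] at hent
  have hbound : 2 * h / d ≤ 1 + log (2 * π * ξ) := by
    rw [div_le_iff₀ hd']
    have hsimp : π / (1 / (2 * ξ)) = 2 * π * ξ := by field_simp
    have hhalf : 1 / (2 * ξ) * (d * ξ) = d / 2 := by field_simp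
    rw [hsimp, hhalf] at hent
    linarith
  calc (1 / (2 * π * exp 1)) * exp (2 * h / d)
      ≤ (1 / (2 * π * exp 1)) * exp (1 + log (2 * π * ξ)) := by gcongr
    _ = ξ := by
      rw [exp_add, exp_log (by positivity)]
      field_simp
end

section
/- Let f : ℝ → ℝ be a nonnegative measurable probability density with respect to Lebesgue measure (∫ f = 1), with finite mean μ = ∫ t f(t) dt and finite variance σ² = ∫ (t − μ)² f(t) dt, where σ² > 0, and suppose f log f is Lebesgue integrable. Then the differential entropy h(f) = -∫ f(t) log f(t) dt satisfies h(f) ≤ (1/2) · log(2πe σ²). -/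
open MeasureTheory Real

theorem neg_mul_log_le_sub_sub_mul_log {a b : ℝ} (ha : 0 ≤ a) (hb : 0 < b) :
    -(a * log a) ≤ b - a - a * log b := by
  rcases ha.eq_or_lt with rfl | ha
  · simpa using hb.le
  · have h := mul_le_mul_of_nonneg_left (log_le_sub_one_of_pos (div_pos hb ha)) ha.le
    rw [log_div hb.ne' ha.ne', mul_sub, mul_sub, mul_div_cancel₀ _ ha.ne'] at h
    linarith

theorem log_gaussianPDFReal (m : ℝ) {v : NNReal} (hv : v ≠ 0) (t : ℝ) :
    log (ProbabilityTheory.gaussianPDFReal m v t) =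
      -(1 / 2 * log (2 * π * v)) - (t - m) ^ 2 / (2 * v) := by
  have hv' : (0 : ℝ) < v := by exact_mod_cast pos_iff_ne_zero.mpr hv
  rw [ProbabilityTheory.gaussianPDFReal, log_mul (by positivity) (exp_pos _).ne', log_exp,
    log_inv, log_sqrt (by positivity)]
  ring

/-- Maximum-entropy property of the Gaussian: a real density with variance `σ²` has
differential entropy at most `(1/2)·log(2πe σ²)`. -/
theorem entropy_le_half_log_two_pi_e_var
    (f : ℝ → ℝ) (hfmeas : Measurable f) (hf0 : ∀ t, 0 ≤ f t)
    (hf1 : ∫ t, f t = 1)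
    (μ σ2 : ℝ)
    (hμint : Integrable (fun t => t * f t)) (hμ : μ = ∫ t, t * f t)
    (hσint : Integrable (fun t => (t - μ) ^ 2 * f t))
    (hσ : σ2 = ∫ t, (t - μ) ^ 2 * f t) (hσpos : 0 < σ2)
    (hlog : Integrable (fun t => f t * Real.log (f t))) :
    -∫ t, f t * Real.log (f t) ≤ (1 / 2) * Real.log (2 * Real.pi * Real.exp 1 * σ2) := by
  have hf : Integrable f := Integrable.of_integral_ne_zero (by simp [hf1])
  lift σ2 to NNReal using hσpos.le
  have hv : σ2 ≠ 0 := by rintro rfl; simp at hσpos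
  have hg := ProbabilityTheory.integrable_gaussianPDFReal μ σ2
  have hfc := hf.const_mul (1 / 2 * log (2 * π * σ2))
  have hfσ := hσint.const_mul (1 / (2 * (σ2 : ℝ)))
  have hle := integral_mono hlog.neg (((hg.sub hf).add hfc).add hfσ) fun t => by
    have h := neg_mul_log_le_sub_sub_mul_log (hf0 t)
      (ProbabilityTheory.gaussianPDFReal_pos μ σ2 t hv)
    rw [log_gaussianPDFReal μ hv] at h
    simp only [Pi.neg_apply, Pi.add_apply, Pi.sub_apply]
    refine h.trans (le_of_eq ?_)
    ring
  rw [integral_add' ((hg.sub hf).add hfc) hfσ, integral_add' (hg.sub hf) hfc,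
    integral_sub' hg hf, integral_const_mul, integral_const_mul, ← hσ, hf1,
    ProbabilityTheory.integral_gaussianPDFReal_eq_one μ hv, integral_neg'] at hle
  have hhalf : 1 / (2 * (σ2 : ℝ)) * σ2 = 1 / 2 := by field_simp
  have hlogeq : log (2 * π * exp 1 * σ2) = log (2 * π * σ2) + 1 := by
    rw [mul_right_comm, log_mul (by positivity) (exp_pos 1).ne', log_exp]
  rw [hlogeq]
  linarith
end

section
/- Let d be a positive integer and f : ℝ^d → ℝ a nonnegative measurable probability density with respect to Lebesgue measure (∫ f = 1), with finite mean vector μ = ∫ x f(x) dx and finite covariance matrix Σ with entries Σᵢⱼ = ∫ (xᵢ − μᵢ)(xⱼ − μⱼ) f(x) dx, and suppose f log f is Lebesgue integrable and det Σ > 0. Then the differential entropy h(f) = -∫ f(x) log f(x) dx satisfies h(f) ≤ (1/2) · log( (2πe)^d · det Σ ). -/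
open MeasureTheory Real

/-- **Gibbs' inequality**: the entropy of a density is at most its cross entropy relative to
any positive density. -/
lemma neg_integral_mul_log_le_neg_integral_mul_log {α : Type*} [MeasurableSpace α]
    {ν : Measure α} {f g : α → ℝ} (hf0 : ∀ x, 0 ≤ f x) (hg0 : ∀ x, 0 < g x)
    (hf1 : ∫ x, f x ∂ν = 1) (hg1 : ∫ x, g x ∂ν = 1)
    (hff : Integrable (fun x => f x * log (f x)) ν)
    (hfg : Integrable (fun x => f x * log (g x)) ν) :
    -∫ x, f x * log (f x) ∂ν ≤ -∫ x, f x * log (g x) ∂ν := by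
  have hfi : Integrable f ν := integrable_of_integral_eq_one hf1
  have hgi : Integrable g ν := integrable_of_integral_eq_one hg1
  have hpt : ∀ x, f x * log (g x) - f x * log (f x) ≤ g x - f x := by
    intro x
    rcases (hf0 x).eq_or_lt with h | h
    · simp [← h, (hg0 x).le]
    · have h1 : log (g x / f x) ≤ g x / f x - 1 := log_le_sub_one_of_pos (div_pos (hg0 x) h)
      rw [log_div (hg0 x).ne' h.ne'] at h1
      calc f x * log (g x) - f x * log (f x) = f x * (log (g x) - log (f x)) := by ring
        _ ≤ f x * (g x / f x - 1) := by gcongr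
        _ = g x - f x := by field_simp
  have h := integral_mono (hfg.sub hff) (hgi.sub hfi) hpt
  simp only [Pi.sub_apply] at h
  rw [integral_sub hfg hff, integral_sub hgi hfi, hf1, hg1] at h
  linarith

lemma integral_exp_neg_half_norm_sq_linearMap_sub {E : Type*} [NormedAddCommGroup E]
    [InnerProductSpace ℝ E] [FiniteDimensional ℝ E] [MeasurableSpace E] [BorelSpace E]
    {L : E →ₗ[ℝ] E} (hL : LinearMap.det L ≠ 0) (m : E) :
    ∫ x, exp (-(1 / 2) * ‖L (x - m)‖ ^ 2) =
      |LinearMap.det L|⁻¹ * (2 * π) ^ (Module.finrank ℝ E / 2 : ℝ) := by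
  have hemb : MeasurableEmbedding L :=
    (L.equivOfDetNeZero hL).toContinuousLinearEquiv.toHomeomorph.measurableEmbedding
  rw [integral_sub_right_eq_self (fun x => exp (-(1 / 2) * ‖L x‖ ^ 2)) m,
    ← hemb.integral_map (g := fun y => exp (-(1 / 2) * ‖y‖ ^ 2)),
    Measure.map_linearMap_addHaar_eq_smul_addHaar volume hL, integral_smul_measure,
    ENNReal.toReal_ofReal (abs_nonneg _),
    GaussianFourier.integral_rexp_neg_mul_sq_norm (by norm_num : (0 : ℝ) < 1 / 2), abs_inv,
    smul_eq_mul, div_div_eq_mul_div, div_one, mul_comm π 2]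

/-- A matrix of second moments against a nonnegative weight is positive semidefinite. -/
lemma Matrix.posSemidef_integral_mul_mul {ι α : Type*} [Fintype ι] [MeasurableSpace α]
    {ν : Measure α} {w : α → ℝ} (hw : ∀ x, 0 ≤ w x) (u : α → ι → ℝ)
    (hint : ∀ i j, Integrable (fun x => u x i * u x j * w x) ν) :
    (Matrix.of fun i j => ∫ x, u x i * u x j * w x ∂ν).PosSemidef := by
  refine .of_dotProduct_mulVec_nonneg ?_ fun v => ?_
  · ext i j
    simp [mul_comm (u _ i)]
  · have h : star v ⬝ᵥ (Matrix.of fun i j => ∫ x, u x i * u x j * w x ∂ν).mulVec v =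
        ∫ x, (∑ i, v i * u x i) ^ 2 * w x ∂ν := by
      have hexp : ∀ x, (∑ i, v i * u x i) ^ 2 * w x =
          ∑ i, ∑ j, v i * v j * (u x i * u x j * w x) := by
        intro x
        rw [sq, Finset.sum_mul_sum, Finset.sum_mul]
        refine Finset.sum_congr rfl fun i _ => ?_
        rw [Finset.sum_mul]
        exact Finset.sum_congr rfl fun j _ => by ring
      simp_rw [hexp]
      rw [integral_finsetSum _ fun i _ => integrable_finsetSum _ fun j _ =>
        (hint i j).const_mul _]
      simp only [dotProduct, Matrix.mulVec, Matrix.of_apply, star_trivial, Finset.mul_sum]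
      refine Finset.sum_congr rfl fun i _ => ?_
      rw [integral_finsetSum _ fun j _ => (hint i j).const_mul _]
      refine Finset.sum_congr rfl fun j _ => ?_
      rw [integral_const_mul]
      ring
    rw [h]
    exact integral_nonneg fun x => mul_nonneg (sq_nonneg _) (hw x)

lemma Matrix.norm_toEuclideanLin_sq {ι : Type*} [Fintype ι] [DecidableEq ι]
    (A : Matrix ι ι ℝ) (y : EuclideanSpace ℝ ι) :
    ‖A.toEuclideanLin y‖ ^ 2 = ∑ i, ∑ j, (star A * A) i j * (y i * y j) := by
  have h : ‖A.toEuclideanLin y‖ ^ 2 = A.mulVec y ⬝ᵥ A.mulVec y := by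
    rw [EuclideanSpace.real_norm_sq_eq]
    simp [dotProduct, sq, Matrix.toLpLin_apply]
  rw [h, Matrix.dotProduct_mulVec, ← Matrix.mulVec_transpose, Matrix.mulVec_mulVec,
    dotProduct_comm]
  simp only [dotProduct, Matrix.mulVec, Finset.mul_sum, Matrix.star_eq_conjTranspose,
    Matrix.conjTranspose_eq_transpose_of_trivial]
  exact Finset.sum_congr rfl fun i _ => Finset.sum_congr rfl fun j _ => by ring

open scoped MatrixOrder in
lemma Matrix.PosDef.exists_star_mul_self_eq_inv {ι : Type*} [Fintype ι] [DecidableEq ι]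
    {C : Matrix ι ι ℝ} (hC : C.PosDef) : ∃ A : Matrix ι ι ℝ, star A * A = C⁻¹ := by
  obtain ⟨A, hA⟩ := CStarAlgebra.nonneg_iff_eq_star_mul_self.mp hC.inv.posSemidef.nonneg
  exact ⟨A, hA.symm⟩

/-- Maximum-entropy property of the multivariate Gaussian: a density on `ℝ^d` with covariance
matrix `C` has differential entropy at most `(1/2)·log((2πe)^d · det C)`. -/
theorem entropy_le_half_log_two_pi_e_det_cov
    (d : ℕ) (hd : 0 < d)
    (f : EuclideanSpace ℝ (Fin d) → ℝ)
    (hfmeas : Measurable f) (hf0 : ∀ x, 0 ≤ f x)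
    (hf1 : ∫ x, f x = 1)
    (μ : Fin d → ℝ)
    (hμint : ∀ i, Integrable (fun x : EuclideanSpace ℝ (Fin d) => x i * f x))
    (hμ : ∀ i, μ i = ∫ x : EuclideanSpace ℝ (Fin d), x i * f x)
    (C : Matrix (Fin d) (Fin d) ℝ)
    (hCint : ∀ i j, Integrable (fun x : EuclideanSpace ℝ (Fin d) =>
      (x i - μ i) * (x j - μ j) * f x))
    (hC : ∀ i j, C i j = ∫ x : EuclideanSpace ℝ (Fin d), (x i - μ i) * (x j - μ j) * f x)
    (hdet : 0 < C.det)
    (hlog : Integrable (fun x => f x * Real.log (f x))) :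
    -∫ x, f x * Real.log (f x) ≤
      (1 / 2) * Real.log ((2 * Real.pi * Real.exp 1) ^ d * C.det) := by
  have hCeq : C = Matrix.of fun i j => ∫ x : EuclideanSpace ℝ (Fin d),
      (x i - μ i) * (x j - μ j) * f x := by
    ext i j
    exact hC i j
  have hCpsd : C.PosSemidef := by
    rw [hCeq]
    exact Matrix.posSemidef_integral_mul_mul hf0 (fun x i => x i - μ i) hCint
  obtain ⟨A, hA⟩ :=
    (hCpsd.posDef_iff_det_ne_zero.mpr hdet.ne').exists_star_mul_self_eq_inv
  have hAdet : A.det ^ 2 = C.det⁻¹ := by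
    have h := congrArg Matrix.det hA
    rwa [Matrix.det_mul, Matrix.star_eq_conjTranspose, Matrix.det_conjTranspose, star_trivial,
      ← sq, Matrix.det_nonsing_inv, Ring.inverse_eq_inv] at h
  have hA0 : A.det ≠ 0 := by
    intro h
    rw [h] at hAdet
    exact (inv_pos.mpr hdet).ne (by simpa using hAdet)
  have hLdet : LinearMap.det A.toEuclideanLin = A.det := by
    rw [Matrix.toEuclideanLin, Matrix.toLpLin_eq_toLin, LinearMap.det_toLin]
  set m : EuclideanSpace ℝ (Fin d) := WithLp.toLp 2 μ
  set q : EuclideanSpace ℝ (Fin d) → ℝ := fun x => ‖A.toEuclideanLin (x - m)‖ ^ 2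
  set c : ℝ := |A.det| * (2 * π) ^ (-(d / 2 : ℝ))
  have hc : 0 < c := by positivity
  have hq : ∀ x, f x * q x =
      ∑ i, ∑ j, C⁻¹ i j * ((x i - μ i) * (x j - μ j) * f x) := by
    intro x
    simp only [q, m, Matrix.norm_toEuclideanLin_sq, hA, PiLp.sub_apply, Finset.mul_sum]
    exact Finset.sum_congr rfl fun i _ => Finset.sum_congr rfl fun j _ => by ring
  have hqint : Integrable fun x => f x * q x := by
    simp_rw [hq]
    exact integrable_finsetSum _ fun i _ => integrable_finsetSum _ fun j _ =>
      (hCint i j).const_mul _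
  have hqd : ∫ x, f x * q x = d := by
    have hsum : ∀ i, ∫ x : EuclideanSpace ℝ (Fin d),
        ∑ j, C⁻¹ i j * ((x i - μ i) * (x j - μ j) * f x) = (C⁻¹ * C) i i := by
      intro i
      rw [integral_finsetSum _ fun j _ => (hCint i j).const_mul _, Matrix.mul_apply]
      refine Finset.sum_congr rfl fun j _ => ?_
      rw [integral_const_mul, ← hC i j, ← hCpsd.1.apply i j, star_trivial]
    simp_rw [hq]
    rw [integral_finsetSum]
    · simp [hsum, Matrix.nonsing_inv_mul C hdet.ne'.isUnit]
    · exact fun i _ => integrable_finsetSum _ fun j _ => (hCint i j).const_mul _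
  have hfi : Integrable f := integrable_of_integral_eq_one hf1
  have hg1 : ∫ x, c * exp (-(1 / 2) * q x) = 1 := by
    rw [integral_const_mul,
      integral_exp_neg_half_norm_sq_linearMap_sub (by rwa [hLdet]) m, hLdet,
      finrank_euclideanSpace, Fintype.card_fin]
    simp only [c]
    rw [rpow_neg (by positivity)]
    have : |A.det| ≠ 0 := abs_ne_zero.mpr hA0
    field_simp
  have hlogg : ∀ x, f x * log (c * exp (-(1 / 2) * q x)) =
      log c * f x - 1 / 2 * (f x * q x) := by
    intro x
    rw [log_mul hc.ne' (exp_pos _).ne', log_exp]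
    ring
  have hgint : Integrable fun x => f x * log (c * exp (-(1 / 2) * q x)) := by
    simp_rw [hlogg]
    exact (hfi.const_mul _).sub (hqint.const_mul _)
  have hmain := neg_integral_mul_log_le_neg_integral_mul_log hf0
    (fun x => mul_pos hc (exp_pos _)) hf1 hg1 hlog hgint
  simp_rw [hlogg] at hmain
  rw [integral_sub (hfi.const_mul _) (hqint.const_mul _), integral_const_mul,
    integral_const_mul, hf1, hqd] at hmain
  have hlogA : 2 * log |A.det| = -log C.det := by
    rw [← log_inv, ← hAdet, log_pow, log_abs]
    norm_num
  have hlogc : log c = log |A.det| - d / 2 * log (2 * π) := by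
    simp only [c]
    rw [log_mul (abs_ne_zero.mpr hA0) (by positivity), log_rpow (by positivity)]
    ring
  have hrhs : log ((2 * π * exp 1) ^ d * C.det) = d * (log (2 * π) + 1) + log C.det := by
    rw [log_mul (by positivity) hdet.ne', log_pow, log_mul (by positivity) (exp_pos 1).ne',
      log_exp]
  rw [hrhs]
  linarith
end
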